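/- arXiv:1212.2818 — 3 statements merged into one kernel-verified Lean document; each statement's English description precedes it below -/
import Mathlib

section
/- Let m be a positive integer. For every complex number z with |z| < 1, the series Σ_{k=1}^∞ (J_m(k)/k)·(−Log(1−z^k)) converges absolutely and its sum equals Σ_{k=1}^∞ k^{m−1} z^k; equivalently, (1/(1−z)) ∏_{k=2}^∞ (1/(1−z^k))^{J_m(k)/k} = exp(Σ_{k=1}^∞ k^{m−1} z^k). -/
/-- The Jordan totient `J_m(k) = k^m ∏_{p prime, p ∣ k} (1 − p^{−m})`. -/
def jordanTotient (m k : ℕ) : ℚ :=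
  (k : ℚ) ^ m * ∏ p ∈ k.primeFactors, (1 - ((p : ℚ) ^ m)⁻¹)

open ArithmeticFunction in
/-- Jordan's totient of positive order, as an arithmetic function. -/
def jordanTotientArith (m : ℕ) (hm : 0 < m) : ArithmeticFunction ℚ :=
  ⟨jordanTotient m, by simp [jordanTotient, hm.ne']⟩

lemma jordanTotient_one (m : ℕ) : jordanTotient m 1 = 1 := by
  simp [jordanTotient]

lemma jordanTotient_mul_of_coprime (m : ℕ) {a b : ℕ} (hab : a.Coprime b) :
    jordanTotient m (a * b) = jordanTotient m a * jordanTotient m b := by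
  rw [jordanTotient, hab.primeFactors_mul, Finset.prod_union hab.disjoint_primeFactors]
  simp only [jordanTotient]
  push_cast
  ring

lemma jordanTotient_prime_pow_succ (m : ℕ) {p : ℕ} (hp : p.Prime) (i : ℕ) :
    jordanTotient m (p ^ (i + 1)) = ((p : ℚ) ^ (i + 1)) ^ m - ((p : ℚ) ^ i) ^ m := by
  have : (p : ℚ) ^ m ≠ 0 := pow_ne_zero _ (by exact_mod_cast hp.ne_zero)
  rw [jordanTotient, Nat.primeFactors_prime_pow i.succ_ne_zero hp, Finset.prod_singleton]
  push_cast
  rw [pow_succ, mul_pow]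
  field_simp

lemma sum_range_jordanTotient_prime_pow (m : ℕ) {p : ℕ} (hp : p.Prime) (i : ℕ) :
    ∑ j ∈ Finset.range (i + 1), jordanTotient m (p ^ j) = ((p : ℚ) ^ i) ^ m := by
  induction i with
  | zero => simp [jordanTotient_one]
  | succ i ih => rw [Finset.sum_range_succ, ih, jordanTotient_prime_pow_succ m hp]; ring

open ArithmeticFunction ArithmeticFunction.zeta in
lemma jordanTotientArith_mul_zeta (m : ℕ) (hm : 0 < m) :
    jordanTotientArith m hm * (ζ : ArithmeticFunction ℚ) =
      (ArithmeticFunction.pow m : ArithmeticFunction ℚ) := by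
  have hJ : (jordanTotientArith m hm).IsMultiplicative :=
    ⟨jordanTotient_one m, fun hab => jordanTotient_mul_of_coprime m hab⟩
  refine ((hJ.mul isMultiplicative_zeta.natCast).eq_iff_eq_on_prime_powers _ _
    isMultiplicative_pow.natCast).2 fun p i hp => ?_
  rw [coe_mul_zeta_apply, Nat.sum_divisors_prime_pow hp, natCoe_apply, pow_apply,
    if_neg (by simp [hm.ne'])]
  push_cast
  exact sum_range_jordanTotient_prime_pow m hp i

/-- Summing Jordan's totient over the divisors of `n` gives `n ^ m`. -/
lemma sum_divisors_jordanTotient (m : ℕ) (hm : 0 < m) (n : ℕ) :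
    ∑ d ∈ n.divisors, jordanTotient m d = (n : ℚ) ^ m := by
  have h := congrArg (fun f => f n) (jordanTotientArith_mul_zeta m hm)
  simp only [ArithmeticFunction.coe_mul_zeta_apply, ArithmeticFunction.natCoe_apply,
    ArithmeticFunction.pow_apply, hm.ne', false_and, if_false] at h
  exact_mod_cast h

lemma norm_jordanTotient_le (m k : ℕ) : ‖(jordanTotient m k : ℂ)‖ ≤ (k : ℝ) ^ m := by
  have hnn : ∀ p ∈ k.primeFactors, (0 : ℚ) ≤ 1 - ((p : ℚ) ^ m)⁻¹ := fun p hp =>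
    sub_nonneg.2 (inv_le_one_of_one_le₀ (one_le_pow₀
      (by exact_mod_cast (Nat.prime_of_mem_primeFactors hp).one_le)))
  have h0 : 0 ≤ jordanTotient m k := mul_nonneg (by positivity) (Finset.prod_nonneg hnn)
  have h1 : jordanTotient m k ≤ (k : ℚ) ^ m :=
    mul_le_of_le_one_right (by positivity) (Finset.prod_le_one hnn fun p _ =>
      sub_le_self _ (by positivity))
  rw [Complex.norm_ratCast, abs_of_nonneg (by exact_mod_cast h0)]
  exact_mod_cast h1

lemma norm_pow_lt_one_of_pos {z : ℂ} (hz : ‖z‖ < 1) {n : ℕ} (hn : 0 < n) : ‖z ^ n‖ < 1 := by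
  rw [norm_pow]
  exact pow_lt_one₀ (norm_nonneg _) hz hn.ne'

/-- A logarithmic Lambert series with coefficients of polynomial growth, rearranged as a
power series. -/
lemma hasSum_mul_neg_log_one_sub_pow {a : ℕ → ℂ} {k : ℕ} (ha : ∀ n, ‖a n‖ ≤ (n : ℝ) ^ k)
    {z : ℂ} (hz : ‖z‖ < 1) :
    HasSum (fun n : ℕ+ => a n * -Complex.log (1 - z ^ (n : ℕ)))
      (∑' n : ℕ+, (∑ d ∈ (n : ℕ).divisors, d * a d) / n * z ^ (n : ℕ)) := by
  set F : ℕ+ × ℕ+ → ℂ := fun c => a c.1 * (z ^ (c.1 * c.2 : ℕ) / (c.2 : ℕ)) with hF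
  have hsum : Summable F := by
    have h := (Equiv.prodComm ℕ+ ℕ+).summable_iff.2
      (summable_prod_mul_pow k (r := ‖z‖) (by simpa using hz))
    refine Summable.of_norm_bounded h fun c => ?_
    have hc : (1 : ℝ) ≤ (c.2 : ℕ) := by exact_mod_cast c.2.pos
    simp only [hF, Function.comp_apply, Equiv.prodComm_apply, Prod.fst_swap, Prod.snd_swap,
      norm_mul, norm_div, norm_pow, Complex.norm_natCast]
    rw [mul_comm (c.2 : ℕ)]
    exact mul_le_mul (ha _) (div_le_self (by positivity) hc) (by positivity) (by positivity)
  have hfib : ∀ n : ℕ+, HasSum (fun j : ℕ+ => F (n, j)) (a n * -Complex.log (1 - z ^ (n : ℕ))) := by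
    intro n
    refine HasSum.mul_left _ ?_
    rw [← Equiv.pnatEquivNat.symm.hasSum_iff]
    convert! Complex.hasSum_taylorSeries_neg_log' (norm_pow_lt_one_of_pos hz n.pos) using 2 with j
    simp [pow_mul]
  convert! hsum.hasSum.prod_fiberwise hfib using 1
  have hsig := (sigmaAntidiagonalEquivProd.hasSum_iff.2 hsum.hasSum).sigma
    fun n => hasSum_fintype _
  rw [← hsig.tsum_eq]
  refine tsum_congr fun n => ?_
  have hn : (n : ℂ) ≠ 0 := by exact_mod_cast n.ne_zero
  have key : ∀ x ∈ (n : ℕ).divisorsAntidiagonal,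
      a x.1 * (z ^ (x.1 * x.2) / (x.2 : ℂ)) = x.1 * a x.1 / n * z ^ (n : ℕ) := by
    intro x hx
    obtain ⟨hx, -⟩ := Nat.mem_divisorsAntidiagonal.1 hx
    have hx' : (x.1 : ℂ) * x.2 = n := by exact_mod_cast hx
    rw [hx]
    have h2 : (x.2 : ℂ) ≠ 0 := right_ne_zero_of_mul (hx' ▸ hn)
    field_simp
    rw [← hx']
    ring
  calc _ = ∑ x ∈ (n : ℕ).divisorsAntidiagonal, x.1 * a x.1 / n * z ^ (n : ℕ) := by
        rw [Nat.sum_divisorsAntidiagonal (fun d _ => d * a d / n * z ^ (n : ℕ)),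
          Finset.sum_div, Finset.sum_mul]
    _ = ∑ x ∈ (n : ℕ).divisorsAntidiagonal, a x.1 * (z ^ (x.1 * x.2) / (x.2 : ℂ)) :=
        (Finset.sum_congr rfl key).symm
    _ = _ := (Finset.sum_coe_sort _ _).symm

lemma Complex.one_div_one_sub_cpow {w : ℂ} (hw : ‖w‖ < 1) (c : ℂ) :
    (1 / (1 - w)) ^ c = Complex.exp (c * -Complex.log (1 - w)) := by
  have hs : 1 - w ∈ Complex.slitPlane := by
    simpa [sub_eq_add_neg] using Complex.mem_slitPlane_of_norm_lt_one (z := -w) (by simpa using hw)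
  rw [one_div, Complex.cpow_def_of_ne_zero (inv_ne_zero (Complex.slitPlane_ne_zero hs)),
    Complex.log_inv _ (Complex.slitPlane_arg_ne_pi hs), mul_comm]

/-- For `m ≥ 1` and `|z| < 1`: the series `Σ_{k≥1} (J_m(k)/k)(−Log(1−z^k))`
converges (absolutely) to `Σ_{k≥1} k^{m−1} z^k`; equivalently
`(1/(1−z)) ∏_{k=2}^∞ (1/(1−z^k))^{J_m(k)/k} = exp(Σ_{k≥1} k^{m−1} z^k)`. -/
theorem jordanTotient_product (m : ℕ) (hm : 0 < m) (z : ℂ) (hz : ‖z‖ < 1) :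
    HasSum (fun k : ℕ =>
        ((jordanTotient m (k + 1) : ℂ) / ((k + 1 : ℕ) : ℂ)) * (-(Complex.log (1 - z ^ (k + 1)))))
      (∑' k : ℕ, ((k + 1 : ℕ) : ℂ) ^ (m - 1) * z ^ (k + 1)) ∧
    (1 / (1 - z)) * ∏' k : ℕ,
        (1 / (1 - z ^ (k + 2))) ^ ((jordanTotient m (k + 2) : ℂ) / ((k + 2 : ℕ) : ℂ)) =
      Complex.exp (∑' k : ℕ, ((k + 1 : ℕ) : ℂ) ^ (m - 1) * z ^ (k + 1)) := by
  have hbound : ∀ n : ℕ, ‖(jordanTotient m n : ℂ) / (n : ℂ)‖ ≤ (n : ℝ) ^ m := by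
    intro n
    rw [norm_div, Complex.norm_natCast]
    rcases n.eq_zero_or_pos with rfl | hn
    · simp
    · exact (div_le_self (norm_nonneg _) (by exact_mod_cast hn)).trans
        (norm_jordanTotient_le m n)
  have hcoeff : ∀ n : ℕ+, (∑ d ∈ (n : ℕ).divisors, (d : ℂ) * ((jordanTotient m d : ℂ) / d)) / n =
      (n : ℂ) ^ (m - 1) := by
    intro n
    have hn : (n : ℂ) ≠ 0 := by exact_mod_cast n.ne_zero
    have : ∑ d ∈ (n : ℕ).divisors, (d : ℂ) * ((jordanTotient m d : ℂ) / d) = (n : ℂ) ^ m := by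
      rw [Finset.sum_congr rfl fun d hd => mul_div_cancel₀ _
        (Nat.cast_ne_zero.2 (Nat.pos_of_mem_divisors hd).ne')]
      exact_mod_cast congrArg (fun q : ℚ => (q : ℂ)) (sum_divisors_jordanTotient m hm n)
    rw [this, div_eq_iff hn, ← pow_succ, Nat.sub_add_cancel hm]
  have hS : HasSum (fun k : ℕ =>
        ((jordanTotient m (k + 1) : ℂ) / ((k + 1 : ℕ) : ℂ)) * (-(Complex.log (1 - z ^ (k + 1)))))
      (∑' k : ℕ, ((k + 1 : ℕ) : ℂ) ^ (m - 1) * z ^ (k + 1)) := by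
    have h := hasSum_mul_neg_log_one_sub_pow hbound hz
    simp only [hcoeff] at h
    rw [← Equiv.pnatEquivNat.symm.hasSum_iff, ← Equiv.pnatEquivNat.symm.tsum_eq] at h
    exact h
  refine ⟨hS, ?_⟩
  have hprod := ((hasSum_nat_add_iff' 1).2 hS).cexp
  have hz1 : (1 / (1 - z)) = Complex.exp (-Complex.log (1 - z)) := by
    simpa using Complex.one_div_one_sub_cpow hz 1
  rw [tprod_congr fun k => Complex.one_div_one_sub_cpow
    (norm_pow_lt_one_of_pos hz (Nat.succ_pos (k + 1))) _]
  erw [hprod.tprod_eq]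
  rw [hz1, ← Complex.exp_add]
  simp [jordanTotient_one]
end

section
/- Let n be a positive integer, let (a_k), (b_k), (c_k) (1 ≤ k ≤ n) be complex numbers, and let x be a complex number such that exp(b_k x/k) ≠ 1 and exp(c_k x/k) ≠ 1 for every 1 ≤ k ≤ n. Then Σ_{k=1}^n a_k · (1−exp(b_k x))/(1−exp(b_k x/k)) · (1−exp(c_k x))/(1−exp(c_k x/k)) = Σ_{k=1}^n a_k + Σ_{m=2}^n Σ_{k=1}^{⌊n/m⌋} a_{mk} Σ_{(j₁,j₂)} exp((b_{mk} j₁ + c_{mk} j₂)·x/m), where the inner sum ranges over all pairs of integers (j₁,j₂) with 0 ≤ j₁ < m, 0 ≤ j₂ < m, (j₁,j₂) ≠ (0,0) and gcd(j₁,j₂,m) = 1. -/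
/-- Pairs of integers `(j₁,j₂)` with `0 ≤ j₁,j₂ < m`, `(j₁,j₂) ≠ (0,0)` and
`gcd(j₁,j₂,m) = 1`. -/
def visiblePairs (m : ℕ) : Finset (Fin m × Fin m) :=
  Finset.univ.filter fun p =>
    ((p.1 : ℕ) ≠ 0 ∨ (p.2 : ℕ) ≠ 0) ∧ Nat.gcd (Nat.gcd (p.1 : ℕ) (p.2 : ℕ)) m = 1

/-- The pairs below `N` grouped by `m = N / gcd`: each is a multiple of a unique primitive pair. -/
theorem sum_range_product_eq_sum_divisors {M : Type*} [AddCommMonoid M] (N : ℕ) (hN : 0 < N)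
    (f : ℕ × ℕ → M) :
    ∑ p ∈ Finset.range N ×ˢ Finset.range N, f p =
      ∑ m ∈ N.divisors, ∑ p ∈ Finset.range m ×ˢ Finset.range m with
        Nat.gcd (Nat.gcd p.1 p.2) m = 1, f (p.1 * (N / m), p.2 * (N / m)) := by
  rw [Finset.sum_sigma']
  symm
  refine Finset.sum_bij' (fun q _ => (q.2.1 * (N / q.1), q.2.2 * (N / q.1)))
    (fun p _ => ⟨N / Nat.gcd (Nat.gcd p.1 p.2) N,
      (p.1 / Nat.gcd (Nat.gcd p.1 p.2) N, p.2 / Nat.gcd (Nat.gcd p.1 p.2) N)⟩) ?_ ?_ ?_ ?_ ?_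
  · rintro ⟨m, i, j⟩ h
    simp only [Finset.mem_sigma, Nat.mem_divisors, Finset.mem_filter, Finset.mem_product,
      Finset.mem_range] at h ⊢
    obtain ⟨⟨⟨k, rfl⟩, -⟩, ⟨hi, hj⟩, -⟩ := h
    have hm : 0 < m := by omega
    have hk : 0 < k := Nat.pos_of_mul_pos_left hN
    rw [Nat.mul_div_cancel_left k hm]
    exact ⟨Nat.mul_lt_mul_of_pos_right hi hk, Nat.mul_lt_mul_of_pos_right hj hk⟩
  · rintro ⟨i, j⟩ h
    simp only [Finset.mem_sigma, Nat.mem_divisors, Finset.mem_filter, Finset.mem_product,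
      Finset.mem_range] at h ⊢
    have hg : 0 < Nat.gcd (Nat.gcd i j) N := Nat.gcd_pos_of_pos_right _ hN
    have hgi : Nat.gcd (Nat.gcd i j) N ∣ i := (Nat.gcd_dvd_left _ _).trans (Nat.gcd_dvd_left _ _)
    have hgj : Nat.gcd (Nat.gcd i j) N ∣ j := (Nat.gcd_dvd_left _ _).trans (Nat.gcd_dvd_right _ _)
    have hgN : Nat.gcd (Nat.gcd i j) N ∣ N := Nat.gcd_dvd_right _ _
    refine ⟨⟨Nat.div_dvd_of_dvd hgN, hN.ne'⟩,
      ⟨Nat.div_lt_div_of_lt_of_dvd hgN h.1, Nat.div_lt_div_of_lt_of_dvd hgN h.2⟩, ?_⟩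
    rw [Nat.gcd_div hgi hgj, Nat.gcd_div (Nat.gcd_dvd_left _ _) hgN, Nat.div_self hg]
  · rintro ⟨m, i, j⟩ h
    simp only [Finset.mem_sigma, Nat.mem_divisors, Finset.mem_filter, Finset.mem_product,
      Finset.mem_range] at h ⊢
    obtain ⟨⟨⟨k, rfl⟩, -⟩, ⟨hi, hj⟩, hg⟩ := h
    have hm : 0 < m := by omega
    have hk : 0 < k := Nat.pos_of_mul_pos_left hN
    rw [Nat.mul_div_cancel_left k hm, Nat.gcd_mul_right, Nat.gcd_mul_right, hg, one_mul,
      Nat.mul_div_cancel _ hk, Nat.mul_div_cancel _ hk, Nat.mul_div_cancel _ hk]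
  · rintro ⟨i, j⟩ -
    have hgN : Nat.gcd (Nat.gcd i j) N ∣ N := Nat.gcd_dvd_right _ _
    dsimp only
    rw [Nat.div_div_self hgN hN.ne',
      Nat.div_mul_cancel ((Nat.gcd_dvd_left _ _).trans (Nat.gcd_dvd_left _ _)),
      Nat.div_mul_cancel ((Nat.gcd_dvd_left _ _).trans (Nat.gcd_dvd_right _ _))]
  · intro _ _
    rfl

theorem sum_Icc_sum_divisors_eq {M : Type*} [AddCommMonoid M] (n : ℕ) (g : ℕ → ℕ → M) :
    ∑ N ∈ Finset.Icc 1 n, ∑ m ∈ N.divisors, g N m =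
      ∑ m ∈ Finset.Icc 1 n, ∑ k ∈ Finset.Icc 1 (n / m), g (m * k) m := by
  rw [Finset.sum_sigma', Finset.sum_sigma']
  refine Finset.sum_bij' (fun q _ => ⟨q.2, q.1 / q.2⟩) (fun q _ => ⟨q.1 * q.2, q.1⟩)
    ?_ ?_ ?_ ?_ ?_
  · rintro ⟨N, m⟩ h
    simp only [Finset.mem_sigma, Nat.mem_divisors, Finset.mem_Icc] at h ⊢
    obtain ⟨⟨hN, hNn⟩, hd, -⟩ := h
    exact ⟨⟨Nat.pos_of_dvd_of_pos hd hN, (Nat.le_of_dvd hN hd).trans hNn⟩,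
      Nat.div_pos (Nat.le_of_dvd hN hd) (Nat.pos_of_dvd_of_pos hd hN), Nat.div_le_div_right hNn⟩
  · rintro ⟨m, k⟩ h
    simp only [Finset.mem_sigma, Nat.mem_divisors, Finset.mem_Icc] at h ⊢
    obtain ⟨⟨hm, -⟩, hk, hkn⟩ := h
    have hpos : 0 < m * k := Nat.mul_pos hm hk
    exact ⟨⟨hpos, (Nat.mul_le_mul_left m hkn).trans (Nat.mul_div_le n m)⟩,
      dvd_mul_right m k, hpos.ne'⟩
  · rintro ⟨N, m⟩ h
    simp only [Finset.mem_sigma, Nat.mem_divisors] at h ⊢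
    rw [Nat.mul_div_cancel' h.2.1]
  · rintro ⟨m, k⟩ h
    simp only [Finset.mem_sigma, Finset.mem_Icc] at h ⊢
    rw [Nat.mul_div_cancel_left k h.1.1]
  · rintro ⟨N, m⟩ h
    simp only [Finset.mem_sigma, Nat.mem_divisors] at h ⊢
    rw [Nat.mul_div_cancel' h.2.1]

theorem sum_visiblePairs {M : Type*} [AddCommMonoid M] {m : ℕ} (hm : 2 ≤ m) (f : ℕ × ℕ → M) :
    ∑ p ∈ visiblePairs m, f ((p.1 : ℕ), (p.2 : ℕ)) =
      ∑ p ∈ Finset.range m ×ˢ Finset.range m with Nat.gcd (Nat.gcd p.1 p.2) m = 1, f p := by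
  refine Finset.sum_bij (fun p _ => ((p.1 : ℕ), (p.2 : ℕ))) ?_ ?_ ?_ ?_
  · intro p h
    simp only [visiblePairs, Finset.mem_filter] at h
    simp [h.2.2]
  · rintro ⟨i, j⟩ - ⟨i', j'⟩ - h
    simpa [Fin.ext_iff] using h
  · rintro ⟨i, j⟩ h
    simp only [Finset.mem_filter, Finset.mem_product, Finset.mem_range] at h
    obtain ⟨⟨hi, hj⟩, hg⟩ := h
    refine ⟨(⟨i, hi⟩, ⟨j, hj⟩), ?_, rfl⟩
    simp only [visiblePairs, Finset.mem_filter, Finset.mem_univ, true_and]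
    refine ⟨?_, hg⟩
    by_contra! h0
    obtain ⟨rfl, rfl⟩ := h0
    simp at hg
    omega
  · intro _ _
    rfl

theorem one_sub_exp_div_eq_sum {z : ℂ} {N : ℕ} (hN : 0 < N) (hz : Complex.exp (z / N) ≠ 1) :
    (1 - Complex.exp z) / (1 - Complex.exp (z / N)) =
      ∑ i ∈ Finset.range N, Complex.exp (z / N * i) := by
  have hN' : (N : ℂ) ≠ 0 := Nat.cast_ne_zero.mpr hN.ne'
  have h : Complex.exp z = Complex.exp (z / N) ^ N := by
    rw [← Complex.exp_nat_mul, mul_div_cancel₀ z hN']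
  have hs : ∀ i : ℕ, Complex.exp (z / N * i) = Complex.exp (z / N) ^ i := fun i => by
    rw [← Complex.exp_nat_mul, mul_comm]
  simp_rw [hs]
  rw [geom_sum_eq hz, h, ← neg_sub, ← neg_sub (Complex.exp (z / N)), neg_div_neg_eq]

/-- The three-dimensional finite visible-point-vector summation formula:
`Σ_{k=1}^n a_k (1−e^{b_k x})/(1−e^{b_k x/k}) · (1−e^{c_k x})/(1−e^{c_k x/k})
  = Σ_{k=1}^n a_k + Σ_{m=2}^n Σ_{k=1}^{⌊n/m⌋} a_{mk} Σ_{(j₁,j₂)} e^{(b_{mk}j₁+c_{mk}j₂)x/m}`,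
the inner sum over `0 ≤ j₁,j₂ < m`, `(j₁,j₂) ≠ (0,0)`, `gcd(j₁,j₂,m) = 1`. -/
theorem vpv_summation_3d (n : ℕ) (hn : 0 < n) (a b c : ℕ → ℂ) (x : ℂ)
    (hb : ∀ k ∈ Finset.Icc 1 n, Complex.exp (b k * x / (k : ℂ)) ≠ 1)
    (hc : ∀ k ∈ Finset.Icc 1 n, Complex.exp (c k * x / (k : ℂ)) ≠ 1) :
    ∑ k ∈ Finset.Icc 1 n,
        a k * ((1 - Complex.exp (b k * x)) / (1 - Complex.exp (b k * x / (k : ℂ)))) *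
          ((1 - Complex.exp (c k * x)) / (1 - Complex.exp (c k * x / (k : ℂ)))) =
      (∑ k ∈ Finset.Icc 1 n, a k) +
        ∑ m ∈ Finset.Icc 2 n, ∑ k ∈ Finset.Icc 1 (n / m),
          a (m * k) * ∑ p ∈ visiblePairs m,
            Complex.exp ((b (m * k) * ((p.1 : ℕ) : ℂ) + c (m * k) * ((p.2 : ℕ) : ℂ)) * x / (m : ℂ)) := by
  have key : ∀ N ∈ Finset.Icc 1 n,
      a N * ((1 - Complex.exp (b N * x)) / (1 - Complex.exp (b N * x / (N : ℂ)))) *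
          ((1 - Complex.exp (c N * x)) / (1 - Complex.exp (c N * x / (N : ℂ)))) =
        ∑ m ∈ N.divisors, a N * ∑ p ∈ Finset.range m ×ˢ Finset.range m with
          Nat.gcd (Nat.gcd p.1 p.2) m = 1,
            Complex.exp ((b N * (p.1 : ℂ) + c N * (p.2 : ℂ)) * x / (m : ℂ)) := by
    intro N hN
    have hpos : 0 < N := (Finset.mem_Icc.mp hN).1
    rw [one_sub_exp_div_eq_sum hpos (hb N hN), one_sub_exp_div_eq_sum hpos (hc N hN), mul_assoc,
      Finset.sum_mul_sum, ← Finset.sum_product',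
      sum_range_product_eq_sum_divisors N hpos, Finset.mul_sum]
    refine Finset.sum_congr rfl fun m hm => ?_
    obtain ⟨k, rfl⟩ := Nat.dvd_of_mem_divisors hm
    have hm0 : 0 < m := Nat.pos_of_mul_pos_right hpos
    have hk0 : 0 < k := Nat.pos_of_mul_pos_left hpos
    have hmC : (m : ℂ) ≠ 0 := Nat.cast_ne_zero.mpr hm0.ne'
    have hkC : (k : ℂ) ≠ 0 := Nat.cast_ne_zero.mpr hk0.ne'
    congr 1
    refine Finset.sum_congr rfl fun p _ => ?_
    rw [← Complex.exp_add, Nat.mul_div_cancel_left k hm0]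
    congr 1
    push_cast
    field_simp
  have hIcc : Finset.Icc 1 n = insert 1 (Finset.Icc 2 n) := by
    ext m
    simp only [Finset.mem_insert, Finset.mem_Icc]
    omega
  rw [Finset.sum_congr rfl key, sum_Icc_sum_divisors_eq, hIcc, Finset.sum_insert (by simp), ← hIcc]
  congr 1
  · simp
  · refine Finset.sum_congr rfl fun m hm => Finset.sum_congr rfl fun k _ => ?_
    rw [← sum_visiblePairs (Finset.mem_Icc.mp hm).1
      (fun p => Complex.exp ((b (m * k) * (p.1 : ℂ) + c (m * k) * (p.2 : ℂ)) * x / (m : ℂ)))]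
end

section
/- For all positive integers m and n, n = Σ_{k=1}^n 1/k^m + Σ_{j=2}^n (J_m(j)/j^m) · Σ_{k=1}^{⌊n/j⌋} 1/k^m (an identity of rational numbers). -/
open ArithmeticFunction

/-- If `g` is completely multiplicative, then the Dirichlet convolution of
`n ↦ ∏ p ∣ n, (1 - g p)` with `g` is the constant function `1` on positive integers. -/
theorem prodPrimeFactors_one_sub_mul_eq_zeta {R : Type*} [CommRing R]
    {g : ArithmeticFunction R} (h_one : g 1 = 1) (h_mul : ∀ a b, g (a * b) = g a * g b) :
    prodPrimeFactors (fun p ↦ 1 - g p) * g = (zeta : ArithmeticFunction R) := by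
  have hg : g.IsMultiplicative := ⟨h_one, fun _ ↦ h_mul _ _⟩
  rw [((IsMultiplicative.prodPrimeFactors _).mul hg).eq_iff_eq_on_prime_powers _ _
    isMultiplicative_zeta.natCast]
  intro p k hp
  have hexpand (k : ℕ) : (prodPrimeFactors (fun p ↦ 1 - g p) * g) (p ^ k) =
      ∑ i ∈ Finset.range (k + 1),
        prodPrimeFactors (fun p ↦ 1 - g p) (p ^ i) * g (p ^ (k - i)) := by
    rw [mul_apply, Nat.sum_divisorsAntidiagonal
      (fun a b ↦ prodPrimeFactors (fun p ↦ 1 - g p) a * g b), Nat.sum_divisors_prime_pow hp]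
    refine Finset.sum_congr rfl fun i hi ↦ ?_
    rw [Nat.pow_div (Finset.mem_range_succ_iff.mp hi) hp.pos]
  have hzeta : (zeta : ArithmeticFunction R) (p ^ k) = 1 := by simp [hp.ne_zero]
  rw [hzeta]
  induction k with
  | zero => simp [h_one]
  | succ k ih =>
    specialize ih (by simp [hp.ne_zero])
    rw [hexpand] at ih ⊢
    have hstep : ∑ i ∈ Finset.range (k + 1),
        prodPrimeFactors (fun p ↦ 1 - g p) (p ^ i) * g (p ^ (k + 1 - i)) = g p := by
      trans (∑ i ∈ Finset.range (k + 1),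
          prodPrimeFactors (fun p ↦ 1 - g p) (p ^ i) * g (p ^ (k - i))) * g p
      swap; · rw [ih, one_mul]
      rw [Finset.sum_mul]
      refine Finset.sum_congr rfl fun i hi ↦ ?_
      rw [Nat.succ_sub (Finset.mem_range_succ_iff.mp hi), pow_succ, h_mul, mul_assoc]
    rw [Finset.sum_range_succ, hstep, prodPrimeFactors_apply (pow_ne_zero _ hp.ne_zero),
      Nat.primeFactors_prime_pow k.succ_ne_zero hp]
    simp [h_one]

/-- For positive integers `m`, `n` (as rational numbers):
`n = Σ_{k=1}^n 1/k^m + Σ_{j=2}^n (J_m(j)/j^m) Σ_{k=1}^{⌊n/j⌋} 1/k^m`. -/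
theorem jordan_totient_partial_sum_identity (m n : ℕ) (hm : 0 < m) (hn : 0 < n) :
    (n : ℚ) =
      (∑ k ∈ Finset.Icc 1 n, 1 / (k : ℚ) ^ m) +
        ∑ j ∈ Finset.Icc 2 n,
          jordanTotient m j / (j : ℚ) ^ m * ∑ k ∈ Finset.Icc 1 (n / j), 1 / (k : ℚ) ^ m := by
  let g : ArithmeticFunction ℚ := ⟨fun k ↦ 1 / (k : ℚ) ^ m, by simp [hm.ne']⟩
  have hconv : prodPrimeFactors (fun p ↦ 1 - g p) * g = (zeta : ArithmeticFunction ℚ) :=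
    prodPrimeFactors_one_sub_mul_eq_zeta (by simp [g])
      fun a b ↦ by simp [g, mul_pow, mul_comm]
  have hf (j : ℕ) (hj : j ≠ 0) :
      prodPrimeFactors (fun p ↦ 1 - g p) j = jordanTotient m j / (j : ℚ) ^ m := by
    simp [prodPrimeFactors_apply hj, jordanTotient, g, hj]
  have hsum := sum_Ioc_mul_eq_sum_sum (prodPrimeFactors fun p ↦ 1 - g p) g n
  have hzeta : ∑ k ∈ Finset.Ioc 0 n, (zeta : ArithmeticFunction ℚ) k = n := by
    simp_rw [natCoe_apply]
    exact_mod_cast sum_Ioc_zeta n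
  rw [hconv, hzeta, ← Finset.Icc_succ_left_eq_Ioc, Nat.succ_eq_succ,
    ← Finset.add_sum_Ioc_eq_sum_Icc hn, ← Finset.Icc_succ_left_eq_Ioc] at hsum
  rw [hsum]
  congr 1
  · simp [prodPrimeFactors_apply, g]
  · refine Finset.sum_congr rfl fun j hj ↦ ?_
    rw [hf j (by have := (Finset.mem_Icc.mp hj).1; grind), ← Finset.Icc_succ_left_eq_Ioc]
    rfl
end
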